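/- A graph G of odd order has no near perfect matching if and only if there exists a set S ⊆ V(G) with c_o(G − S) ≥ |S| + 3. -/

import Mathlib

open SimpleGraph

/-- `D` is a dominating set of `G`: every vertex is in `D` or adjacent to a vertex of `D`. -/
def IsDomSet {V : Type*} (G : SimpleGraph V) (D : Set V) : Prop :=
  ∀ v, v ∈ D ∨ ∃ u ∈ D, G.Adj u v

/-- The domination number `γ(G)`. -/
noncomputable def domNum {V : Type*} (G : SimpleGraph V) : ℕ :=
  sInf {n | ∃ D : Set V, IsDomSet G D ∧ D.ncard = n}

/-- `D` is a dominating set of the vertex-deleted graph `G - x`. -/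
def IsDomSetAvoiding {V : Type*} (G : SimpleGraph V) (x : V) (D : Set V) : Prop :=
  x ∉ D ∧ ∀ v, v ≠ x → v ∈ D ∨ ∃ u ∈ D, G.Adj u v

/-- The domination number of the vertex-deleted graph `G - x`. -/
noncomputable def domNumDel {V : Type*} (G : SimpleGraph V) (x : V) : ℕ :=
  sInf {n | ∃ D : Set V, IsDomSetAvoiding G x D ∧ D.ncard = n}

/-- `G` is `k`-`γ`-vertex-critical: `γ(G) = k` and `γ(G - v) < k` for every vertex `v`. -/
def GammaCritical {V : Type*} (G : SimpleGraph V) (k : ℕ) : Prop :=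
  domNum G = k ∧ ∀ v : V, domNumDel G v < k

/-- `G` is `K_{1,n}`-free: it has no induced subgraph isomorphic to the star `K_{1,n}`. -/
def StarFree {V : Type*} (G : SimpleGraph V) (n : ℕ) : Prop :=
  ¬ ∃ (c : V) (T : Finset V), T.card = n ∧ (∀ t ∈ T, G.Adj c t) ∧
      ∀ t ∈ T, ∀ t' ∈ T, t ≠ t' → ¬ G.Adj t t'

/-- `G` has a perfect matching. -/
def HasPerfectMatching {V : Type*} (G : SimpleGraph V) : Prop :=
  ∃ M : G.Subgraph, M.IsPerfectMatching

/-- `G` has a near perfect matching: a matching covering all but exactly one vertex. -/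
def HasNearPerfectMatching {V : Type*} (G : SimpleGraph V) : Prop :=
  ∃ (M : G.Subgraph) (v : V), M.IsMatching ∧ M.verts = {v}ᶜ

/-- `c_o(G - S)`: the number of odd components of `G - S`. -/
noncomputable def numOddComponents {V : Type*} (G : SimpleGraph V) (S : Set V) : ℕ :=
  Nat.card {c : (G.induce Sᶜ).ConnectedComponent // Odd c.supp.ncard}

/-- The cone over `G`: the graph obtained by adding a vertex adjacent to every vertex of `G`. -/
def SimpleGraph.cone {V : Type*} (G : SimpleGraph V) : SimpleGraph (Option V) where
  Adj x y := x ≠ y ∧ ∀ a ∈ x, ∀ b ∈ y, G.Adj a b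
  symm := ⟨fun _ _ h => ⟨h.1.symm, fun a ha b hb => (h.2 b hb a ha).symm⟩⟩
  loopless := ⟨fun _ h => h.1 rfl⟩

theorem SimpleGraph.cone_adj_some_some {V : Type*} {G : SimpleGraph V} {a b : V} :
    G.cone.Adj (some a) (some b) ↔ G.Adj a b := by
  simpa [SimpleGraph.cone] using fun h : G.Adj a b => h.ne

theorem SimpleGraph.cone_adj_none_some {V : Type*} {G : SimpleGraph V} (a : V) :
    G.cone.Adj none (some a) := by
  simp [SimpleGraph.cone]

theorem SimpleGraph.Iso.natCard_oddComponents_eq {V W : Type*} {G : SimpleGraph V}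
    {H : SimpleGraph W} (e : G ≃g H) :
    Nat.card {c : G.ConnectedComponent // Odd c.supp.ncard} =
      Nat.card {c : H.ConnectedComponent // Odd c.supp.ncard} := by
  refine Nat.card_congr (e.connectedComponentEquiv.subtypeEquiv fun c => ?_)
  have h : c.supp.ncard = (e.connectedComponentEquiv c).supp.ncard :=
    Nat.card_congr (ConnectedComponent.isoEquivSupp e c)
  rw [h]

/-- Deleting a set of vertices as a subgraph is the same as inducing on its complement. -/
def SimpleGraph.deleteVertsTopIsoInduceCompl {V : Type*} (G : SimpleGraph V) (S : Set V) :
    ((⊤ : G.Subgraph).deleteVerts S).coe ≃g G.induce Sᶜ where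
  toEquiv := Equiv.subtypeEquivRight fun v => by simp
  map_rel_iff' {a b} := by
    have ha := a.2
    have hb := b.2
    simp at ha hb
    simp [ha, hb]

theorem SimpleGraph.isTutteViolator_iff_lt_numOddComponents {V : Type*} (G : SimpleGraph V)
    (S : Set V) : G.IsTutteViolator S ↔ S.ncard < numOddComponents G S := by
  rw [numOddComponents, ← (G.deleteVertsTopIsoInduceCompl S).natCard_oddComponents_eq]
  rfl

/-- Deleting the apex of the cone and a set `S` leaves `G - S`. -/
noncomputable def SimpleGraph.induceComplIsoConeInduceCompl {V : Type*} (G : SimpleGraph V)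
    (S : Set V) : G.induce Sᶜ ≃g G.cone.induce (insert none (some '' S))ᶜ where
  toEquiv := Equiv.ofBijective (fun a => ⟨some a.1, by
      simpa only [Set.mem_compl_iff, Set.mem_insert_iff, reduceCtorEq, false_or,
        (Option.some_injective V).mem_set_image] using a.2⟩) <| by
    refine ⟨fun a b h => by simpa [Subtype.ext_iff] using h, fun ⟨x, hx⟩ => ?_⟩
    cases x with
    | none => simp at hx
    | some a => exact ⟨⟨a, by simpa using hx⟩, rfl⟩
  map_rel_iff' := cone_adj_some_some

theorem SimpleGraph.isTutteViolator_cone_insert_none {V : Type*} [Finite V] (G : SimpleGraph V)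
    (S : Set V) :
    G.cone.IsTutteViolator (insert none (some '' S)) ↔ S.ncard + 1 < numOddComponents G S := by
  rw [isTutteViolator_iff_lt_numOddComponents, Set.ncard_insert_of_notMem (by simp),
    Set.ncard_image_of_injective _ (Option.some_injective V), numOddComponents, numOddComponents,
    (G.induceComplIsoConeInduceCompl S).natCard_oddComponents_eq]

theorem SimpleGraph.odd_ncard_add_numOddComponents {V : Type*} [Finite V] (G : SimpleGraph V)
    (S : Set V) : Odd (S.ncard + numOddComponents G S) ↔ Odd (Nat.card V) := by
  have h : Odd (numOddComponents G S) ↔ Odd Sᶜ.ncard := (G.induce Sᶜ).odd_ncard_oddComponents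
  rw [← Set.ncard_add_ncard_compl S, Nat.odd_add', Nat.odd_add', h]

theorem SimpleGraph.none_mem_of_isTutteViolator_cone {V : Type*} [Finite V] {G : SimpleGraph V}
    (hodd : Odd (Nat.card V)) {T : Set (Option V)} (hT : G.cone.IsTutteViolator T) :
    none ∈ T := by
  by_contra hn
  rw [isTutteViolator_iff_lt_numOddComponents] at hT
  have hsub : Subsingleton (G.cone.induce Tᶜ).ConnectedComponent := by
    refine Preconnected.subsingleton_connectedComponent fun x y => ?_
    have key (z : (Tᶜ : Set (Option V))) : (G.cone.induce Tᶜ).Reachable ⟨none, hn⟩ z := by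
      obtain ⟨_ | z, hz⟩ := z
      · rfl
      · exact Adj.reachable (cone_adj_none_some z)
    exact (key x).symm.trans (key y)
  have hle : numOddComponents G.cone T ≤ 1 := Finite.card_le_one_iff_subsingleton.mpr inferInstance
  have hpar := G.cone.odd_ncard_add_numOddComponents T
  rw [Finite.card_option, Nat.odd_add_one, show T.ncard + numOddComponents G.cone T = 1 by omega]
    at hpar
  exact hpar.mp odd_one hodd

theorem SimpleGraph.hasNearPerfectMatching_iff_hasPerfectMatching_cone {V : Type*}
    (G : SimpleGraph V) : HasNearPerfectMatching G ↔ HasPerfectMatching G.cone := by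
  constructor
  · rintro ⟨M, v, hM, hv⟩
    have hvM (w : V) : w ∈ M.verts ↔ w ≠ v := by simp [hv]
    let N : G.cone.Subgraph :=
      { verts := Set.univ
        Adj := fun x y => match x, y with
          | some a, some b => M.Adj a b
          | none, some b => b = v
          | some a, none => a = v
          | none, none => False
        adj_sub := by
          rintro (_ | a) (_ | b) h
          · exact h.elim
          · exact cone_adj_none_some b
          · exact (cone_adj_none_some a).symm
          · exact cone_adj_some_some.mpr (M.adj_sub h)
        edge_vert := fun _ => Set.mem_univ _
        symm := ⟨by
          rintro (_ | a) (_ | b) h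
          · exact h
          · exact h
          · exact h
          · exact M.adj_symm h⟩ }
    refine ⟨N, Subgraph.isPerfectMatching_iff.mpr ?_⟩
    rintro (_ | a)
    · refine ⟨some v, rfl, ?_⟩
      rintro (_ | b) h
      · exact h.elim
      · exact congrArg some h
    · by_cases ha : a = v
      · refine ⟨none, ha, ?_⟩
        rintro (_ | b) h
        · rfl
        · exact absurd ha ((hvM a).mp (M.edge_vert h))
      · obtain ⟨b, hb, hu⟩ := hM ((hvM a).mpr ha)
        refine ⟨some b, hb, ?_⟩
        rintro (_ | c) h
        · exact absurd h ha
        · exact congrArg some (hu c h)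
  · rintro ⟨N, hN⟩
    rw [Subgraph.isPerfectMatching_iff] at hN
    obtain ⟨_ | v, hv, huv⟩ := hN none
    · exact absurd rfl (N.adj_sub hv).ne
    have hne {a b : V} (h : N.Adj (some a) (some b)) : a ≠ v := by
      rintro rfl
      simpa using (hN (some a)).unique h hv.symm
    refine ⟨{ verts := {v}ᶜ
              Adj := fun a b => N.Adj (some a) (some b)
              adj_sub := fun h => cone_adj_some_some.mp (N.adj_sub h)
              edge_vert := hne
              symm := ⟨fun _ _ h => N.adj_symm h⟩ }, v, ?_, rfl⟩
    intro a ha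
    obtain ⟨_ | b, hb, hu⟩ := hN (some a)
    · exact absurd (Option.some_injective V (huv _ hb.symm)) ha
    · exact ⟨b, hb, fun c hc => Option.some_injective V (hu _ hc)⟩

/-- A graph of odd order has no near perfect matching iff there is a set
`S` of vertices with `c_o(G - S) ≥ |S| + 3`. -/
theorem no_nearPerfectMatching_iff_tutte_like
    {V : Type*} [Fintype V] (G : SimpleGraph V) (hodd : Odd (Fintype.card V)) :
    ¬ HasNearPerfectMatching G ↔ ∃ S : Set V, S.ncard + 3 ≤ numOddComponents G S := by
  rw [← Nat.card_eq_fintype_card] at hodd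
  rw [G.hasNearPerfectMatching_iff_hasPerfectMatching_cone, HasPerfectMatching, tutte]
  push Not
  constructor
  · rintro ⟨T, hT⟩
    have hn := none_mem_of_isTutteViolator_cone hodd hT
    have hTS : insert none (some '' (some ⁻¹' T)) = T := by
      ext (_ | a) <;> simp [hn]
    rw [← hTS, isTutteViolator_cone_insert_none] at hT
    refine ⟨some ⁻¹' T, ?_⟩
    obtain ⟨k, hk⟩ := (G.odd_ncard_add_numOddComponents (some ⁻¹' T)).mpr hodd
    omega
  · rintro ⟨S, hS⟩
    exact ⟨_, (G.isTutteViolator_cone_insert_none S).mpr (by omega)⟩
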